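/- For any binary linear block code with minimum Hamming distance d_min transmitted with BPSK over an AWGN channel with noise variance σ², every decoder ψ satisfies FER_ψ ≥ Q(√d_min / σ). -/

import Mathlib

open MeasureTheory ProbabilityTheory

/-- The Gaussian tail function `Q(x) = ∫_x^∞ (1/√(2π)) e^{-t²/2} dt`. -/
noncomputable def Qfun (x : ℝ) : ℝ :=
  ∫ t in Set.Ioi x, (1 / Real.sqrt (2 * Real.pi)) * Real.exp (-(t ^ 2) / 2)

/-- BPSK modulation: bit `b ↦ (-1)^b`. -/
noncomputable def bpsk (b : ZMod 2) : ℝ := if b = 0 then 1 else -1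

/-- The tail function as a standard Gaussian probability. -/
lemma ofReal_Qfun (x : ℝ) : ENNReal.ofReal (Qfun x) = gaussianReal 0 1 (Set.Ioi x) := by
  rw [gaussianReal_apply_eq_integral 0 one_ne_zero]
  simp [Qfun, gaussianPDFReal_def]

/-- The left tail of the standard Gaussian equals its right tail. -/
lemma gaussianReal_zero_one_Iic_neg (x : ℝ) :
    gaussianReal 0 1 (Set.Iic (-x)) = gaussianReal 0 1 (Set.Ioi x) := by
  have : NullSingletonClass (gaussianReal 0 1) := nullSingletonClass_gaussianReal one_ne_zero
  have h : (gaussianReal 0 1).map (fun y ↦ -y) = gaussianReal 0 1 := by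
    simpa using gaussianReal_map_neg (μ := 0) (v := 1)
  conv_lhs => rw [← h, Measure.map_apply measurable_neg measurableSet_Iic]
  rw [measure_congr Ioi_ae_eq_Ici]
  congr 1
  ext y
  simp

/-- The likelihood ratio of two Gaussians that differ in their mean. -/
lemma gaussianReal_eq_withDensity (m : ℝ) {v : NNReal} (hv : v ≠ 0) :
    gaussianReal m v = (gaussianReal 0 v).withDensity
      (fun x ↦ ENNReal.ofReal (Real.exp ((m * x - m ^ 2 / 2) / v))) := by
  rw [gaussianReal_of_var_ne_zero _ hv, gaussianReal_of_var_ne_zero _ hv,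
    ← withDensity_mul _ (measurable_gaussianPDF 0 v) (by fun_prop)]
  congr 1
  ext x
  simp only [Pi.mul_apply, gaussianPDF_def]
  rw [← ENNReal.ofReal_mul (gaussianPDFReal_nonneg _ _ _)]
  simp only [gaussianPDFReal_def]
  rw [mul_assoc _ (Real.exp _), ← Real.exp_add]
  have : (v : ℝ) ≠ 0 := by exact_mod_cast hv
  congr 3
  field_simp
  ring

/-- A product of measures with densities has the product density. -/
lemma pi_withDensity {ι : Type*} [Fintype ι] {X : ι → Type*} [∀ i, MeasurableSpace (X i)]
    (μ : ∀ i, Measure (X i)) [∀ i, IsProbabilityMeasure (μ i)]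
    {f : ∀ i, X i → ENNReal} (hf : ∀ i, Measurable (f i))
    [∀ i, SigmaFinite ((μ i).withDensity (f i))] :
    Measure.pi (fun i ↦ (μ i).withDensity (f i)) =
      (Measure.pi μ).withDensity (fun x ↦ ∏ i, f i (x i)) := by
  refine Measure.pi_eq (μ := fun i ↦ (μ i).withDensity (f i)) fun s hs ↦ ?_
  have hg (i) : Measurable ((s i).indicator (f i)) := (hf i).indicator (hs i)
  rw [withDensity_apply _ (MeasurableSet.univ_pi hs),
    ← lintegral_indicator (MeasurableSet.univ_pi hs)]
  have key : (Set.univ.pi s).indicator (fun x ↦ ∏ i, f i (x i)) =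
      fun x ↦ ∏ i, (s i).indicator (f i) (x i) := by
    ext x
    by_cases hx : x ∈ Set.univ.pi s
    · rw [Set.indicator_of_mem hx]
      exact Finset.prod_congr rfl fun i _ ↦ (Set.indicator_of_mem (hx i trivial) _).symm
    · rw [Set.indicator_of_notMem hx]
      obtain ⟨i, hi⟩ : ∃ i, x i ∉ s i := by simpa using hx
      exact (Finset.prod_eq_zero (Finset.mem_univ i) (Set.indicator_of_notMem hi _)).symm
  rw [key, lintegral_prod_eq_prod_lintegral_of_indepFun Finset.univ
    (fun i (x : ∀ i, X i) ↦ (s i).indicator (f i) (x i))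
    (iIndepFun_pi fun i ↦ (hg i).aemeasurable)
    (fun i ↦ (hg i).comp (measurable_pi_apply i))]
  refine Finset.prod_congr rfl fun i _ ↦ ?_
  rw [withDensity_apply _ (hs i), ← lintegral_indicator (hs i)]
  exact (measurePreserving_eval μ i).lintegral_comp (hg i)

/-- A linear functional of i.i.d. centered Gaussians is Gaussian. -/
lemma pi_gaussianReal_map_sum {ι : Type*} [Fintype ι] (v : NNReal) (a : ι → ℝ) :
    (Measure.pi fun _ : ι ↦ gaussianReal 0 v).map (fun z ↦ ∑ i, a i * z i) =
      gaussianReal 0 (∑ i, (a i ^ 2).toNNReal * v) := by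
  classical
  set μ := Measure.pi fun _ : ι ↦ gaussianReal 0 v
  have hind : iIndepFun (fun i (z : ι → ℝ) ↦ a i * z i) μ :=
    iIndepFun_pi (X := fun i (x : ℝ) ↦ a i * x) fun i ↦ by fun_prop
  have hlaw (i : ι) : μ.map (fun z ↦ a i * z i) = gaussianReal 0 ((a i ^ 2).toNNReal * v) := by
    have h := gaussianReal_map_const_mul (μ := 0) (v := v) (a i)
    rw [← (measurePreserving_eval (fun _ : ι ↦ gaussianReal 0 v) i).map_eq,
      Measure.map_map (by fun_prop) (by fun_prop)] at h
    rw [mul_zero] at h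
    convert h using 3
    · rfl
    · exact Real.toNNReal_of_nonneg (sq_nonneg _)
  suffices ∀ t : Finset ι, μ.map (∑ i ∈ t, fun z ↦ a i * z i) =
      gaussianReal 0 (∑ i ∈ t, (a i ^ 2).toNNReal * v) by
    rw [← this]
    congr 1
    ext z
    simp
  intro t
  induction t using Finset.induction_on with
  | empty => simp [Pi.zero_def, Measure.map_const, gaussianReal_zero_var]
  | insert i t hi ih =>
    rw [Finset.sum_insert hi, Finset.sum_insert hi]
    have h := gaussianReal_add_gaussianReal_of_indepFun
      (hind.indepFun_finsetSum_of_notMem (fun j ↦ by fun_prop) hi).symm (hlaw i) ih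
    simpa using h

/-- Testing between two measures with densities: the sum of the two error probabilities is at
least that of the likelihood-ratio test. -/
lemma likelihood_ratio_test_le {Ω : Type*} [MeasurableSpace Ω] (μ : Measure Ω)
    {f g : Ω → ENNReal} (hf : Measurable f) (hg : Measurable g) {A B : Set Ω}
    (hB : MeasurableSet B) (hA : MeasurableSet A) (hAB : A ∪ B = Set.univ) :
    μ.withDensity f {x | f x ≤ g x} + μ.withDensity g {x | f x ≤ g x}ᶜ ≤
      μ.withDensity f A + μ.withDensity g B := by
  have hH : MeasurableSet {x | f x ≤ g x} := measurableSet_le hf hg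
  rw [withDensity_apply _ hA, withDensity_apply _ hB, withDensity_apply _ hH,
    withDensity_apply _ hH.compl]
  calc _ = ∫⁻ x in {x | f x ≤ g x}, min (f x) (g x) ∂μ +
        ∫⁻ x in {x | f x ≤ g x}ᶜ, min (f x) (g x) ∂μ := by
        congr 1
        · exact setLIntegral_congr_fun hH fun x hx ↦ (min_eq_left hx).symm
        · exact setLIntegral_congr_fun hH.compl fun x hx ↦ (min_eq_right (le_of_not_ge (Set.notMem_of_mem_compl hx))).symm
    _ = ∫⁻ x in A ∪ B, min (f x) (g x) ∂μ := by
        rw [lintegral_add_compl _ hH, hAB, Measure.restrict_univ]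
    _ ≤ ∫⁻ x in A, min (f x) (g x) ∂μ + ∫⁻ x in B, min (f x) (g x) ∂μ :=
        lintegral_union_le _ _ _
    _ ≤ _ := by
        gcongr
        · exact min_le_left _ _
        · exact min_le_right _ _

/-- Translates of a product Gaussian by a vector of signs. -/
lemma pi_gaussianReal_map_add {ι : Type*} [Fintype ι] {v : NNReal} (hv : v ≠ 0) {c : ι → ℝ}
    (hc : ∀ i, c i ^ 2 = 1) :
    (Measure.pi fun _ : ι ↦ gaussianReal 0 v).map (fun z i ↦ c i + z i) =
      (Measure.pi fun _ : ι ↦ gaussianReal 0 v).withDensity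
        (fun y ↦ ENNReal.ofReal (Real.exp ((∑ i, c i * y i - Fintype.card ι / 2) / v))) := by
  have : ∀ i, IsProbabilityMeasure ((gaussianReal 0 v).withDensity
      (fun x ↦ ENNReal.ofReal (Real.exp ((c i * x - c i ^ 2 / 2) / v)))) := fun i ↦ by
    rw [← gaussianReal_eq_withDensity _ hv]
    infer_instance
  have hmap (i) : (gaussianReal 0 v).map (c i + ·) = gaussianReal (c i) v := by
    rw [gaussianReal_map_const_add, zero_add]
  have : ∀ i, SigmaFinite ((gaussianReal 0 v).map (c i + ·)) := fun i ↦ by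
    rw [hmap]
    infer_instance
  rw [Measure.pi_map_pi (f := fun i x ↦ c i + x) (fun i ↦ by fun_prop)]
  simp_rw [hmap, fun i ↦ gaussianReal_eq_withDensity (c i) hv]
  rw [pi_withDensity _ (fun i ↦ by fun_prop)]
  congr 1
  ext y
  rw [← ENNReal.ofReal_prod_of_nonneg fun i _ ↦ (Real.exp_pos _).le, ← Real.exp_sum,
    ← Finset.sum_div, Finset.sum_sub_distrib]
  simp [hc, div_eq_mul_inv]

/-- Two sign vectors at Hamming distance `d > 0` (so with inner product `n - 2 d`), observed in
Gaussian noise, cannot be distinguished with total error below `2 Q(√d / σ)`. -/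
lemma two_mul_Qfun_le {ι : Type*} [Fintype ι] {σ : ℝ} (hσ : 0 < σ) {c c' : ι → ℝ}
    (hc : ∀ i, c i ^ 2 = 1) (hc' : ∀ i, c' i ^ 2 = 1) {d : ℕ} (hd : 0 < d)
    (hcc : ∑ i, (c i - c' i) ^ 2 = 4 * d) {A B : Set (ι → ℝ)}
    (hA : MeasurableSet A) (hB : MeasurableSet B) (hAB : A ∪ B = Set.univ) :
    2 * ENNReal.ofReal (Qfun (√d / σ)) ≤
      Measure.pi (fun _ : ι ↦ gaussianReal 0 (σ ^ 2).toNNReal) {z | (fun i ↦ c i + z i) ∈ A} +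
      Measure.pi (fun _ : ι ↦ gaussianReal 0 (σ ^ 2).toNNReal) {z | (fun i ↦ c' i + z i) ∈ B} := by
  have hv : (σ ^ 2).toNNReal ≠ 0 := by simp [hσ.ne']
  have hvpos : 0 < ((σ ^ 2).toNNReal : ℝ) := by positivity
  set v := (σ ^ 2).toNNReal with hvdef
  set μ := Measure.pi fun _ : ι ↦ gaussianReal 0 v with hμ
  have hm (c : ι → ℝ) : Measurable (fun (z : ι → ℝ) i ↦ c i + z i) := by fun_prop
  have hmL : Measurable (fun z : ι → ℝ ↦ ∑ i, (c i - c' i) * z i) := by fun_prop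
  have key := likelihood_ratio_test_le μ
    (f := fun y ↦ ENNReal.ofReal (Real.exp ((∑ i, c i * y i - Fintype.card ι / 2) / v)))
    (g := fun y ↦ ENNReal.ofReal (Real.exp ((∑ i, c' i * y i - Fintype.card ι / 2) / v)))
    (by fun_prop) (by fun_prop) hB hA hAB
  rw [← pi_gaussianReal_map_add hv hc, ← pi_gaussianReal_map_add hv hc',
    Measure.map_apply (hm c) hA, Measure.map_apply (hm c') hB] at key
  refine le_trans (le_of_eq ?_) key
  have hset : {y : ι → ℝ |
      ENNReal.ofReal (Real.exp ((∑ i, c i * y i - Fintype.card ι / 2) / v)) ≤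
      ENNReal.ofReal (Real.exp ((∑ i, c' i * y i - Fintype.card ι / 2) / v))} =
      {y | ∑ i, (c i - c' i) * y i ≤ 0} := by
    ext y
    simp only [Set.mem_ofPred_eq]
    rw [ENNReal.ofReal_le_ofReal_iff (Real.exp_pos _).le, Real.exp_le_exp,
      div_le_div_iff_of_pos_right hvpos]
    simp [sub_mul]
  have hmH : MeasurableSet {y : ι → ℝ | ∑ i, (c i - c' i) * y i ≤ 0} :=
    measurableSet_le hmL measurable_const
  have hinner : ∑ i, (c i - c' i) * c i = 2 * d ∧ ∑ i, (c i - c' i) * c' i = -(2 * d) := by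
    have h1 : ∑ i, (c i - c' i) * c i = ∑ i, (c i - c' i) ^ 2 / 2 :=
      Finset.sum_congr rfl fun i _ ↦ by linear_combination (hc i - hc' i) / 2
    have h2 : ∑ i, (c i - c' i) * c' i = -∑ i, (c i - c' i) ^ 2 / 2 := by
      rw [← Finset.sum_neg_distrib]
      exact Finset.sum_congr rfl fun i _ ↦ by linear_combination (hc i - hc' i) / 2
    rw [h1, h2, ← Finset.sum_div, hcc]
    constructor <;> ring
  have hsd : 0 < √(d : ℝ) := Real.sqrt_pos.2 (by exact_mod_cast hd)
  have hlaw : μ.map (fun z ↦ ∑ i, (c i - c' i) * z i) =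
      (gaussianReal 0 1).map (2 * √d * σ * ·) := by
    rw [pi_gaussianReal_map_sum, gaussianReal_map_const_mul, mul_zero]
    congr 1
    ext
    push_cast
    simp only [Real.coe_toNNReal _ (sq_nonneg _), hvdef]
    rw [← Finset.sum_mul, hcc, mul_one, mul_pow, mul_pow, Real.sq_sqrt (Nat.cast_nonneg d)]
    ring
  have hthr : 2 * √d * σ * (√d / σ) = 2 * d := by
    field_simp
    rw [Real.sq_sqrt (Nat.cast_nonneg d)]
  have hpos : 0 < 2 * √d * σ := by positivity
  rw [hset, Measure.map_apply (hm c) hmH, Measure.map_apply (hm c') hmH.compl]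
  have e1 : (fun (z : ι → ℝ) i ↦ c i + z i) ⁻¹' {y | ∑ i, (c i - c' i) * y i ≤ 0} =
      (fun z ↦ ∑ i, (c i - c' i) * z i) ⁻¹' Set.Iic (-(2 * d)) := by
    ext z
    simp only [Set.mem_preimage, Set.mem_ofPred_eq, Set.mem_Iic, mul_add, Finset.sum_add_distrib,
      hinner.1]
    constructor <;> intro h <;> linarith
  have e2 : (fun (z : ι → ℝ) i ↦ c' i + z i) ⁻¹' {y | ∑ i, (c i - c' i) * y i ≤ 0}ᶜ =
      (fun z ↦ ∑ i, (c i - c' i) * z i) ⁻¹' Set.Ioi (2 * d) := by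
    ext z
    simp only [Set.mem_preimage, Set.mem_ofPred_eq, Set.mem_Ioi, Set.mem_compl_iff, not_le, mul_add,
      Finset.sum_add_distrib, hinner.2]
    constructor <;> intro h <;> linarith
  rw [e1, e2, ← Measure.map_apply hmL measurableSet_Iic, ← Measure.map_apply hmL measurableSet_Ioi,
    hlaw, Measure.map_apply (by fun_prop) measurableSet_Iic,
    Measure.map_apply (by fun_prop) measurableSet_Ioi, ofReal_Qfun, two_mul]
  congr 1
  · rw [← gaussianReal_zero_one_Iic_neg]
    congr 1
    ext x
    rw [Set.mem_preimage, Set.mem_Iic, Set.mem_Iic, ← hthr, ← mul_neg,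
      mul_le_mul_iff_right₀ hpos]
  · congr 1
    ext x
    rw [Set.mem_preimage, Set.mem_Ioi, Set.mem_Ioi, ← hthr, mul_lt_mul_iff_right₀ hpos]

lemma bpsk_sq (b : ZMod 2) : bpsk b ^ 2 = 1 := by
  unfold bpsk
  split_ifs <;> norm_num

lemma bpsk_sub_bpsk_add_sq (a b : ZMod 2) :
    (bpsk a - bpsk (a + b)) ^ 2 = if b ≠ 0 then 4 else 0 := by
  have h (x : ZMod 2) : x = 0 ∨ x = 1 := by
    fin_cases x
    · exact Or.inl rfl
    · exact Or.inr rfl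
  have h11 : (1 : ZMod 2) + 1 = 0 := rfl
  rcases h a with rfl | rfl <;> rcases h b with rfl | rfl <;> simp [bpsk, h11] <;> norm_num

/-- Flipping `hammingNorm w` bits moves the modulated word by squared distance
`4 * hammingNorm w`. -/
lemma sum_bpsk_sub_bpsk_add_sq {ι : Type*} [Fintype ι] (x w : ι → ZMod 2) :
    ∑ i, (bpsk (x i) - bpsk ((x + w) i)) ^ 2 = 4 * (hammingNorm w : ℝ) := by
  simp only [Pi.add_apply, bpsk_sub_bpsk_add_sq, ← Finset.sum_filter, Finset.sum_const,
    hammingNorm, nsmul_eq_mul]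
  ring

/-- For any binary linear block code with minimum Hamming distance `d_min`, transmitted
with BPSK over an AWGN channel with noise variance `σ²`, every (measurable) decoder `ψ`
satisfies `FER_ψ ≥ Q(√d_min / σ)`. -/
theorem fer_lower_bound_dmin
    (n k : ℕ) (hk : 1 ≤ k) (hkn : k ≤ n) (σ : ℝ) (hσ : 0 < σ)
    -- generator matrix of rank `k`, i.e. with linearly independent rows
    (G : Matrix (Fin k) (Fin n) (ZMod 2))
    (hG : LinearIndependent (ZMod 2) (fun i => G i))
    -- `d_min` is the minimum Hamming weight over the nonzero codewords
    (dmin : ℕ)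
    (hdmin : IsLeast {w : ℕ | ∃ u : Fin k → ZMod 2, u ≠ 0 ∧
        hammingNorm (Matrix.vecMul u G) = w} dmin)
    -- the underlying probability measure: `U` uniform, independent i.i.d. Gaussian noise
    (P : Measure ((Fin k → ZMod 2) × (Fin n → ℝ)))
    (hP : P = ((PMF.uniformOfFintype (Fin k → ZMod 2)).toMeasure).prod
        (Measure.pi fun _ : Fin n => gaussianReal 0 ((σ ^ 2).toNNReal)))
    -- the received vector `Y_j = (-1)^{(UG)_j} + Z_j`
    (Y : (Fin k → ZMod 2) × (Fin n → ℝ) → Fin n → ℝ)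
    (hY : Y = fun ω j => bpsk (Matrix.vecMul ω.1 G j) + ω.2 j)
    -- the decoder and its frame-error probability
    (ψ : (Fin n → ℝ) → Fin k → ZMod 2) (hψ : Measurable ψ)
    (FER : ℝ)
    (hFER : FER = (P {ω | ψ (Y ω) ≠ ω.1}).toReal) :
    Qfun (Real.sqrt (dmin : ℝ) / σ) ≤ FER := by
  obtain ⟨⟨w, hw, hwd⟩, -⟩ := hdmin
  have hd : 0 < dmin := by
    rw [← hwd, hammingNorm_pos_iff]
    intro h
    exact hw ((Matrix.vecMul_injective_iff.2 hG) (by simpa using h))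
  set μ := Measure.pi fun _ : Fin n => gaussianReal 0 ((σ ^ 2).toNNReal) with hμ
  set q := ENNReal.ofReal (Qfun (√(dmin : ℝ) / σ)) with hq
  let F (u : Fin k → ZMod 2) : ENNReal :=
    μ {z | (fun j ↦ bpsk (Matrix.vecMul u G j) + z j) ∈ {y | ψ y ≠ u}}
  have hmeas (u) : MeasurableSet {y | ψ y ≠ u} := (hψ (measurableSet_singleton u)).compl
  have hpair (u) : 2 * q ≤ F u + F (u + w) := by
    refine two_mul_Qfun_le hσ (fun _ ↦ bpsk_sq _) (fun _ ↦ bpsk_sq _) hd ?_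
      (hmeas u) (hmeas (u + w)) ?_
    · rw [Matrix.add_vecMul, sum_bpsk_sub_bpsk_add_sq, hwd]
    · refine Set.eq_univ_of_forall fun y ↦ ?_
      by_cases hy : ψ y = u
      · right
        simp [hy, hw]
      · exact Or.inl hy
  have hYm : Measurable Y := by
    rw [hY]
    refine measurable_pi_lambda _ fun j ↦ ?_
    exact ((measurable_of_countable fun u ↦ bpsk (Matrix.vecMul u G j)).comp measurable_fst).add
      ((measurable_pi_apply j).comp measurable_snd)
  have hS : MeasurableSet {ω | ψ (Y ω) ≠ ω.1} :=
    (measurableSet_eq_fun (hψ.comp hYm) measurable_fst).compl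
  have hPS : P {ω | ψ (Y ω) ≠ ω.1} =
      ∑ u, F u * (Fintype.card (Fin k → ZMod 2) : ENNReal)⁻¹ := by
    rw [hP, Measure.prod_apply hS, lintegral_fintype]
    refine Finset.sum_congr rfl fun u _ ↦ ?_
    rw [PMF.toMeasure_apply_singleton _ _ (measurableSet_singleton u),
      PMF.uniformOfFintype_apply, hY]
    rfl
  have hle : q ≤ P {ω | ψ (Y ω) ≠ ω.1} := by
    have hcard : (Fintype.card (Fin k → ZMod 2) : ENNReal) ≠ 0 :=
      Nat.cast_ne_zero.2 Fintype.card_ne_zero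
    have hsum : ∑ u, F (u + w) = ∑ u, F u := Equiv.sum_comp (Equiv.addRight w) F
    have h2 : 2 * (Fintype.card (Fin k → ZMod 2) * q) ≤ 2 * ∑ u, F u := by
      calc _ = ∑ _u : Fin k → ZMod 2, 2 * q := by
            rw [Finset.sum_const, Finset.card_univ, nsmul_eq_mul]
            ring
        _ ≤ ∑ u, (F u + F (u + w)) := Finset.sum_le_sum fun u _ ↦ hpair u
        _ = _ := by rw [Finset.sum_add_distrib, hsum, two_mul]
    rw [ENNReal.mul_le_mul_iff_right two_ne_zero ENNReal.ofNat_ne_top] at h2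
    rw [hPS, ← Finset.sum_mul, ← div_eq_mul_inv, ENNReal.le_div_iff_mul_le (Or.inl hcard)
      (Or.inl (ENNReal.natCast_ne_top _)), mul_comm]
    exact h2
  have hfin : P {ω | ψ (Y ω) ≠ ω.1} ≠ ⊤ := by
    have : IsProbabilityMeasure P := by
      rw [hP]
      infer_instance
    exact measure_ne_top _ _
  rw [hFER]
  exact (ENNReal.ofReal_le_iff_le_toReal hfin).1 hle
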